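/- For every K-algebra endomorphism σ of I_1 there exist a nonzero scalar λ ∈ K, a scalar μ ∈ K, and an element h ∈ F such that σ(H) = λ·H + μ·1 + h. -/

import Mathlib

set_option linter.unusedSectionVars false

open Polynomial

noncomputable section

variable (K : Type*) [Field K] [CharZero K]

/-- Formal differentiation `∂` as a `K`-linear endomorphism of `K[x]`. -/
def derOp : Module.End K (Polynomial K) := Polynomial.derivative

/-- Multiplication by `x` as a `K`-linear endomorphism of `K[x]`. -/
def xOp : Module.End K (Polynomial K) := LinearMap.mulLeft K (Polynomial.X : Polynomial K)

/-- Integration `∫`: the unique `K`-linear map with `∫ xⁿ = xⁿ⁺¹/(n+1)`. -/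
def intOp : Module.End K (Polynomial K) :=
  Polynomial.lsum fun n => ((n : K) + 1)⁻¹ • Polynomial.monomial (n + 1)

/-- The algebra `I₁` of polynomial integro-differential operators: the unital
`K`-subalgebra of `End_K K[x]` generated by `X`, `∂` and `∫`. -/
def I1 : Subalgebra K (Module.End K (Polynomial K)) :=
  Algebra.adjoin K {xOp K, derOp K, intOp K}

/-- `H := ∂ ∘ X`. -/
def Hop : Module.End K (Polynomial K) := derOp K * xOp K

/-- `e_{ij} := ∫^i ∂^j - ∫^{i+1} ∂^{j+1}`. -/
def eOp (i j : ℕ) : Module.End K (Polynomial K) :=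
  intOp K ^ i * derOp K ^ j - intOp K ^ (i + 1) * derOp K ^ (j + 1)

/-- `F`, the `K`-linear span of the `e_{ij}`. -/
def Fspan : Submodule K (Module.End K (Polynomial K)) :=
  Submodule.span K (Set.range fun p : ℕ × ℕ => eOp K p.1 p.2)

lemma xOp_mem : xOp K ∈ I1 K := Algebra.subset_adjoin (by simp)
lemma derOp_mem : derOp K ∈ I1 K := Algebra.subset_adjoin (by simp)
lemma intOp_mem : intOp K ∈ I1 K := Algebra.subset_adjoin (by simp)
lemma Hop_mem : Hop K ∈ I1 K := mul_mem (derOp_mem K) (xOp_mem K)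
lemma eOp_mem (i j : ℕ) : eOp K i j ∈ I1 K :=
  sub_mem (mul_mem (pow_mem (intOp_mem K) i) (pow_mem (derOp_mem K) j))
    (mul_mem (pow_mem (intOp_mem K) (i + 1)) (pow_mem (derOp_mem K) (j + 1)))

/-- `H` as an element of `I₁`. -/
def HelI : I1 K := ⟨Hop K, Hop_mem K⟩
/-- `∂` as an element of `I₁`. -/
def DelI : I1 K := ⟨derOp K, derOp_mem K⟩
/-- `∫` as an element of `I₁`. -/
def IntI : I1 K := ⟨intOp K, intOp_mem K⟩

/-- The basis vector `x^m / m!`. -/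
def ev (m : ℕ) : Polynomial K := Polynomial.monomial m ((m.factorial : K)⁻¹)

/-- The coordinate functional dual to `ev`. -/
def co (p : ℕ) : Polynomial K →ₗ[K] K := (p.factorial : K) • Polynomial.lcoeff K p

lemma fact_ne (m : ℕ) : (m.factorial : K) ≠ 0 := by
  exact_mod_cast m.factorial_ne_zero

lemma co_ev (p m : ℕ) : co K p (ev K m) = if p = m then 1 else 0 := by
  simp only [co, ev, LinearMap.smul_apply, lcoeff_apply, coeff_monomial, smul_eq_mul]
  by_cases h : m = p
  · subst h; simp only [if_true]; exact mul_inv_cancel₀ (fact_ne K m)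
  · simp [h, Ne.symm h]

lemma co_eq_zero {v : Polynomial K} {p : ℕ} : co K p v = 0 ↔ v.coeff p = 0 := by
  simp [co, Nat.factorial_ne_zero]

lemma co_ext {v w : Polynomial K} (h : ∀ p, co K p v = co K p w) : v = w := by
  ext p
  have := h p
  simpa [co, Nat.factorial_ne_zero] using this

lemma vexp (v : Polynomial K) (L : ℕ) (h : ∀ p, L ≤ p → co K p v = 0) :
    v = ∑ q ∈ Finset.range L, co K q v • ev K q := by
  apply co_ext K
  intro p
  simp only [map_sum, map_smul, co_ev, smul_eq_mul, mul_ite, mul_one, mul_zero,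
    Finset.sum_ite_eq, Finset.mem_range]
  split_ifs with hp
  · rfl
  · exact h p (not_lt.mp hp)

lemma exists_bound (v : Polynomial K) : ∃ L : ℕ, ∀ p, L ≤ p → co K p v = 0 := by
  refine ⟨v.natDegree + 1, fun p hp => ?_⟩
  rw [co_eq_zero]
  exact coeff_eq_zero_of_natDegree_lt (by omega)

lemma end_ext {A B : Module.End K (Polynomial K)} (h : ∀ m, A (ev K m) = B (ev K m)) :
    A = B := by
  refine LinearMap.ext fun v => ?_
  obtain ⟨L, hL⟩ := exists_bound K v
  rw [vexp K v L hL]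
  simp [h]

lemma der_ev_zero : derOp K (ev K 0) = 0 := by
  simp [derOp, ev]

lemma der_ev (m : ℕ) : derOp K (ev K (m + 1)) = ev K m := by
  have h : ((m : K) + 1) ≠ 0 := by exact_mod_cast Nat.succ_ne_zero m
  simp only [derOp, ev, derivative_monomial, Nat.add_sub_cancel, Nat.factorial_succ]
  congr 1
  have := fact_ne K m
  push_cast
  field_simp

lemma int_ev (m : ℕ) : intOp K (ev K m) = ev K (m + 1) := by
  simp only [intOp, ev, lsum_apply, Nat.factorial_succ]
  rw [sum_monomial_index _ _ (by simp)]
  simp only [LinearMap.smul_apply, smul_monomial]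
  congr 1
  have := fact_ne K m
  push_cast
  simp [mul_comm]

lemma x_ev (m : ℕ) : xOp K (ev K m) = ((m : K) + 1) • ev K (m + 1) := by
  have h : ((m : K) + 1) ≠ 0 := by exact_mod_cast Nat.succ_ne_zero m
  simp only [xOp, ev, LinearMap.mulLeft_apply, X_mul_monomial, Nat.factorial_succ, smul_monomial]
  congr 1
  have := fact_ne K m
  push_cast
  simp only [smul_eq_mul]
  field_simp

lemma H_ev (m : ℕ) : Hop K (ev K m) = ((m : K) + 1) • ev K m := by
  simp [Hop, x_ev, der_ev]

lemma rel_DI : derOp K * intOp K = 1 := by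
  apply end_ext K; intro m; simp [int_ev, der_ev]

lemma rel_DH : derOp K * Hop K = Hop K * derOp K + derOp K := by
  apply end_ext K; intro m
  cases m with
  | zero => simp [H_ev, der_ev_zero]
  | succ m => simp [H_ev, der_ev, add_smul]

lemma rel_HI : Hop K * intOp K = intOp K * Hop K + intOp K := by
  apply end_ext K; intro m
  simp [H_ev, int_ev, add_smul]

lemma rel_HP : Hop K * (1 - intOp K * derOp K) = 1 - intOp K * derOp K := by
  apply end_ext K; intro m
  cases m with
  | zero => simp [H_ev, der_ev_zero]
  | succ m => simp [der_ev, int_ev]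

lemma rel_PH : (1 - intOp K * derOp K) * Hop K = 1 - intOp K * derOp K := by
  apply end_ext K; intro m
  cases m with
  | zero => simp [H_ev, der_ev_zero]
  | succ m => simp [der_ev, int_ev, H_ev]

lemma int_pow_ev (i m : ℕ) : (intOp K ^ i) (ev K m) = ev K (m + i) := by
  induction i generalizing m with
  | zero => simp
  | succ i ih => rw [pow_succ, Module.End.mul_apply, int_ev, ih]; congr 1; omega

lemma der_pow_ev (j m : ℕ) : (derOp K ^ j) (ev K m) = if j ≤ m then ev K (m - j) else 0 := by
  induction j generalizing m with
  | zero => simp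
  | succ j ih =>
    rw [pow_succ, Module.End.mul_apply]
    cases m with
    | zero => simp [der_ev_zero]
    | succ m => rw [der_ev, ih]; simp

lemma e_ev (i j m : ℕ) : eOp K i j (ev K m) = if j = m then ev K i else 0 := by
  simp only [eOp, LinearMap.sub_apply, Module.End.mul_apply, der_pow_ev]
  rcases lt_trichotomy j m with h | h | h
  · rw [if_pos h.le, if_pos (by omega), if_neg h.ne, int_pow_ev, int_pow_ev, sub_eq_zero]
    congr 1; omega
  · subst h; simp [int_pow_ev]
  · rw [if_neg (by omega), if_neg (by omega), if_neg (by omega)]; simp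

/-- `a` is the symbol of `A`. -/
def HSym (A : Module.End K (Polynomial K)) (a : ℤ → Polynomial K) (N : ℕ) : Prop :=
  (∀ i : ℤ, (N : ℤ) < |i| → a i = 0) ∧
    ∀ p m : ℕ, (N ≤ p ∨ N ≤ m) → co K p (A (ev K m)) = (a ((p : ℤ) - m)).eval (m : K)

section

variable {K}

lemma HSym.mono {A : Module.End K (Polynomial K)} {a : ℤ → Polynomial K} {N M : ℕ}
    (h : HSym K A a N) (hNM : N ≤ M) : HSym K A a M :=
  ⟨fun i hi => h.1 i (by omega), fun p m hp => h.2 p m (by omega)⟩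

lemma poly_eq {p q : Polynomial K} (N : ℕ) (h : ∀ m : ℕ, N ≤ m → p.eval (m : K) = q.eval (m : K)) :
    p = q := by
  apply Polynomial.eq_of_infinite_eval_eq
  apply Set.Infinite.mono (s := (fun m : ℕ => (m : K)) '' Set.Ici N)
  · rintro _ ⟨m, hm, rfl⟩; exact h m hm
  · exact (Set.Ici_infinite N).image (Nat.cast_injective.injOn)

lemma HSym.unique {A : Module.End K (Polynomial K)} {a b : ℤ → Polynomial K} {N M : ℕ}
    (h : HSym K A a N) (h' : HSym K A b M) : a = b := by
  funext i
  apply poly_eq (N + M + i.natAbs)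
  intro m hm
  have h1 := h.2 (m + i).toNat m (by omega)
  have h2 := h'.2 (m + i).toNat m (by omega)
  have e : (((m + i).toNat : ℕ) : ℤ) - m = i := by omega
  rw [e] at h1 h2
  rw [← h1, ← h2]

lemma HSym.add {A B : Module.End K (Polynomial K)} {a b : ℤ → Polynomial K} {N M : ℕ}
    (h : HSym K A a N) (h' : HSym K B b M) : HSym K (A + B) (a + b) (N + M) :=
  ⟨fun i hi => by simp [h.1 i (by omega), h'.1 i (by omega)],
   fun p m hp => by simp [h.2 p m (by omega), h'.2 p m (by omega)]⟩

lemma HSym.smul {A : Module.End K (Polynomial K)} {a : ℤ → Polynomial K} {N : ℕ}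
    (c : K) (h : HSym K A a N) : HSym K (c • A) (c • a) N :=
  ⟨fun i hi => by simp [h.1 i (by omega)],
   fun p m hp => by simp [h.2 p m (by omega)]⟩

lemma HSym.sub {A B : Module.End K (Polynomial K)} {a b : ℤ → Polynomial K} {N M : ℕ}
    (h : HSym K A a N) (h' : HSym K B b M) : HSym K (A - B) (a - b) (N + M) :=
  ⟨fun i hi => by simp [h.1 i (by omega), h'.1 i (by omega)],
   fun p m hp => by simp [h.2 p m (by omega), h'.2 p m (by omega)]⟩

lemma HSym.one : HSym K 1 (Pi.single 0 1) 0 := by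
  refine ⟨fun i hi => Pi.single_eq_of_ne (by rintro rfl; simp at hi) _, fun p m _ => ?_⟩
  simp only [Module.End.one_apply, co_ev, Pi.single_apply]
  by_cases h : p = m
  · subst h; simp
  · have : ¬ ((p : ℤ) - m = 0) := by omega
    simp [h, this]

lemma HSym.H : HSym K (Hop K) (Pi.single 0 (X + 1)) 0 := by
  refine ⟨fun i hi => Pi.single_eq_of_ne (by rintro rfl; simp at hi) _, fun p m _ => ?_⟩
  simp only [H_ev, map_smul, co_ev, Pi.single_apply]
  by_cases h : p = m
  · subst h; simp
  · have : ¬ ((p : ℤ) - m = 0) := by omega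
    simp [h, this]

lemma HSym.x : HSym K (xOp K) (Pi.single 1 (X + 1)) 1 := by
  refine ⟨fun i hi => Pi.single_eq_of_ne (by rintro rfl; simp at hi) _, fun p m _ => ?_⟩
  simp only [x_ev, map_smul, co_ev, Pi.single_apply]
  by_cases h : p = m + 1
  · subst h; simp
  · have : ¬ ((p : ℤ) - m = 1) := by omega
    simp [h, this]

lemma HSym.int : HSym K (intOp K) (Pi.single 1 1) 1 := by
  refine ⟨fun i hi => Pi.single_eq_of_ne (by rintro rfl; simp at hi) _, fun p m _ => ?_⟩
  simp only [int_ev, co_ev, Pi.single_apply]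
  by_cases h : p = m + 1
  · subst h; simp
  · have : ¬ ((p : ℤ) - m = 1) := by omega
    simp [h, this]

lemma HSym.der : HSym K (derOp K) (Pi.single (-1) 1) 1 := by
  refine ⟨fun i hi => Pi.single_eq_of_ne (by rintro rfl; simp at hi) _, fun p m _ => ?_⟩
  cases m with
  | zero =>
    simp [der_ev_zero]
  | succ m =>
    simp only [der_ev, co_ev, Pi.single_apply]
    by_cases h : p = m
    · subst h; simp
    · have : ¬ ((p : ℤ) - (m + 1 : ℕ) = -1) := by omega
      rw [if_neg h, if_neg this]; simp

/-- product of symbols -/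
def smul' (M : ℕ) (a b : ℤ → Polynomial K) : ℤ → Polynomial K := fun d =>
  ∑ j ∈ Finset.Icc (-M : ℤ) M, (a (d - j)).comp (X + C (j : K)) * b j

lemma ent_mul (A B : Module.End K (Polynomial K)) (p m : ℕ) : ∃ L₀ : ℕ, ∀ L, L₀ ≤ L →
    co K p ((A * B) (ev K m)) =
      ∑ q ∈ Finset.range L, co K p (A (ev K q)) * co K q (B (ev K m)) := by
  obtain ⟨L, hL⟩ := exists_bound K (B (ev K m))
  refine ⟨L, fun L' hL' => ?_⟩
  rw [Module.End.mul_apply]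
  conv_lhs => rw [vexp K (B (ev K m)) L' (fun p hp => hL p (by omega))]
  simp [mul_comm]

lemma HSym.mul {A B : Module.End K (Polynomial K)} {a b : ℤ → Polynomial K} {N M : ℕ}
    (h : HSym K A a N) (h' : HSym K B b M) : HSym K (A * B) (smul' M a b) (2 * (N + M)) := by
  constructor
  · intro i hi
    apply Finset.sum_eq_zero
    intro j hj
    rw [Finset.mem_Icc] at hj
    rw [h.1 (i - j) (by rw [lt_abs] at hi ⊢; push_cast at hi; omega)]
    simp
  · intro p m hpm
    obtain ⟨L₀, hL₀⟩ := ent_mul A B p m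
    rw [hL₀ (L₀ + m + M + 1) (by omega)]
    have key : ∀ q, co K p (A (ev K q)) * co K q (B (ev K m)) =
        (a ((p : ℤ) - q)).eval (q : K) * (b ((q : ℤ) - m)).eval (m : K) := by
      intro q
      rcases hpm with hp | hm
      · rw [h.2 p q (by omega)]
        by_cases hq : M ≤ q
        · rw [h'.2 q m (by omega)]
        · rw [h.1 ((p : ℤ) - q) (by rw [lt_abs]; omega)]; simp
      · rw [h'.2 q m (by omega)]
        by_cases hq : N ≤ q
        · rw [h.2 p q (by omega)]
        · rw [h'.1 ((q : ℤ) - m) (by rw [lt_abs]; omega)]; simp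
    rw [Finset.sum_congr rfl (fun q _ => key q)]
    simp only [smul', eval_finsetSum, eval_mul, eval_comp, eval_add, eval_X, eval_C]
    refine Finset.sum_bij_ne_zero (fun q _ _ => (q : ℤ) - m) ?_ ?_ ?_ ?_
    · intro q _ hq
      rw [Finset.mem_Icc, ← abs_le]
      by_contra hc
      rw [h'.1 _ (not_le.mp hc)] at hq
      simp at hq
    · intro q _ _ q' _ _ hqq
      omega
    · intro j hj hne
      have h1 : |(p : ℤ) - m - j| ≤ N := by
        by_contra hc
        rw [h.1 _ (not_le.mp hc)] at hne
        simp at hne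
      rw [Finset.mem_Icc] at hj
      rw [abs_le] at h1
      have e : (((m + j).toNat : ℕ) : ℤ) = m + j := by omega
      have e3 : (((m + j).toNat : ℕ) : K) = m + j := by
        rw [← Int.cast_natCast, e]; push_cast; rfl
      refine ⟨(m + j).toNat, by rw [Finset.mem_range]; omega, ?_, by omega⟩
      have e1 : (p : ℤ) - (((m + j).toNat : ℕ) : ℤ) = p - m - j := by omega
      have e2 : (((m + j).toNat : ℕ) : ℤ) - m = j := by omega
      rw [e1, e2, e3]
      exact hne
    · intro q _ _
      have e1 : (p : ℤ) - m - (q - m) = p - q := by omega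
      rw [e1]
      congr 2
      push_cast; ring

lemma exists_sym {A : Module.End K (Polynomial K)} (hA : A ∈ I1 K) :
    ∃ a N, HSym K A a N := by
  induction hA using Algebra.adjoin_induction with
  | mem x hx =>
    rcases hx with rfl | rfl | rfl
    · exact ⟨_, _, HSym.x⟩
    · exact ⟨_, _, HSym.der⟩
    · exact ⟨_, _, HSym.int⟩
  | algebraMap r =>
    rw [Algebra.algebraMap_eq_smul_one]
    exact ⟨_, _, HSym.one.smul r⟩
  | add x y _ _ hx hy =>
    obtain ⟨a, N, h⟩ := hx
    obtain ⟨b, M, h'⟩ := hy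
    exact ⟨_, _, h.add h'⟩
  | mul x y _ _ hx hy =>
    obtain ⟨a, N, h⟩ := hx
    obtain ⟨b, M, h'⟩ := hy
    exact ⟨_, _, h.mul h'⟩

lemma mem_F {A : Module.End K (Polynomial K)} {N : ℕ} (h : HSym K A 0 N) : A ∈ Fspan K := by
  have : A = ∑ j ∈ Finset.range N, ∑ i ∈ Finset.range N, co K i (A (ev K j)) • eOp K i j := by
    apply end_ext K
    intro m
    simp only [LinearMap.sum_apply, LinearMap.smul_apply, e_ev]
    by_cases hm : m < N
    · rw [Finset.sum_eq_single m]
      · simp only [if_true]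
        apply vexp K
        intro p hp
        simpa using h.2 p m (by omega)
      · intro j _ hj
        simp [hj]
      · intro hh; simp at hh; omega
    · rw [Finset.sum_eq_zero]
      · apply co_ext K
        intro p
        simpa using h.2 p m (by omega)
      · intro j hj
        rw [Finset.mem_range] at hj
        have : j ≠ m := by omega
        simp [this]
  rw [this]
  exact Submodule.sum_mem _ fun j _ => Submodule.sum_mem _ fun i _ =>
    Submodule.smul_mem _ _ (Submodule.subset_span ⟨(i, j), rfl⟩)

lemma smul'_single {M : ℕ} {a b : ℤ → Polynomial K} (hb : ∀ i : ℤ, (M : ℤ) < |i| → b i = 0)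
    (d j : ℤ) (h : ∀ i, i ≠ j → a (d - i) = 0 ∨ b i = 0) :
    smul' M a b d = (a (d - j)).comp (X + C (j : K)) * b j := by
  apply Finset.sum_eq_single
  · intro i _ hi
    rcases h i hi with h | h <;> simp [h]
  · intro hj
    rw [Finset.mem_Icc, ← abs_le, not_le] at hj
    simp [hb j hj]

lemma exists_top {a : ℤ → Polynomial K} {N : ℕ} (h : ∀ i : ℤ, (N : ℤ) < |i| → a i = 0)
    (ha : ∃ i, a i ≠ 0) : ∃ r, a r ≠ 0 ∧ ∀ i, r < i → a i = 0 := by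
  obtain ⟨r, hr, hr'⟩ := Int.exists_greatest_of_bdd (P := fun i => a i ≠ 0)
    ⟨N, fun z hz => by
      by_contra hc
      exact hz (h z (by rw [lt_abs]; omega))⟩ ha
  exact ⟨r, hr, fun i hi => by by_contra hc; have := hr' i hc; omega⟩

lemma exists_bot {a : ℤ → Polynomial K} {N : ℕ} (h : ∀ i : ℤ, (N : ℤ) < |i| → a i = 0)
    (ha : ∃ i, a i ≠ 0) : ∃ r, a r ≠ 0 ∧ ∀ i, i < r → a i = 0 := by
  obtain ⟨r, hr, hr'⟩ := Int.exists_least_of_bdd (P := fun i => a i ≠ 0)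
    ⟨-N, fun z hz => by
      by_contra hc
      exact hz (h z (by rw [lt_abs]; omega))⟩ ha
  exact ⟨r, hr, fun i hi => by by_contra hc; have := hr' i hc; omega⟩

lemma comp_ne {p : Polynomial K} (c : K) (h : p ≠ 0) : p.comp (X + C c) ≠ 0 := by
  rwa [Ne, comp_X_add_C_eq_zero_iff]

lemma homog {d i : ℤ → Polynomial K} {N M : ℕ} (hd : ∀ j : ℤ, (N : ℤ) < |j| → d j = 0)
    (hi : ∀ j : ℤ, (M : ℤ) < |j| → i j = 0) (h : smul' M d i = Pi.single 0 1) :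
    ∃ (r : ℤ) (u : K), u ≠ 0 ∧ d = Pi.single r (C u) ∧ i = Pi.single (-r) (C u⁻¹) := by
  have hd0 : ∃ j, d j ≠ 0 := by
    by_contra hc
    push Not at hc
    have := congrFun h 0
    simp [smul', hc] at this
  have hi0 : ∃ j, i j ≠ 0 := by
    by_contra hc
    push Not at hc
    have := congrFun h 0
    simp [smul', hc] at this
  obtain ⟨r, hr, hr'⟩ := exists_top hd hd0
  obtain ⟨s, hs, hs'⟩ := exists_bot hd hd0
  obtain ⟨r1, hr1, hr1'⟩ := exists_top hi hi0
  obtain ⟨s1, hs1, hs1'⟩ := exists_bot hi hi0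
  have t := smul'_single (a := d) hi (r + r1) r1 (fun j hj => by
    rcases lt_or_gt_of_ne hj with h | h
    · left; exact hr' _ (by omega)
    · right; exact hr1' _ h)
  have b := smul'_single (a := d) hi (s + s1) s1 (fun j hj => by
    rcases lt_or_gt_of_ne hj with h | h
    · right; exact hs1' _ h
    · left; exact hs' _ (by omega))
  rw [h, Int.add_sub_cancel] at t b
  have t0 : r + r1 = 0 := by
    by_contra hc
    rw [Pi.single_eq_of_ne hc] at t
    exact mul_ne_zero (comp_ne _ hr) hr1 t.symm
  have b0 : s + s1 = 0 := by
    by_contra hc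
    rw [Pi.single_eq_of_ne hc] at b
    exact mul_ne_zero (comp_ne _ hs) hs1 b.symm
  have l1 : s ≤ r := by by_contra hc; exact hs (hr' s (by omega))
  have l2 : s1 ≤ r1 := by by_contra hc; exact hs1 (hr1' s1 (by omega))
  have e1 : s = r := by omega
  have e2 : s1 = r1 := by omega
  have e3 : r1 = -r := by omega
  subst e1 e2 e3
  rw [t0, Pi.single_eq_same] at t
  have u2 : IsUnit (i (-s)) := IsUnit.of_mul_eq_one _ (by rw [mul_comm]; exact t.symm)
  obtain ⟨v, hv, hv'⟩ := Polynomial.isUnit_iff.mp u2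
  have v0 : v ≠ 0 := hv.ne_zero
  have hdc : (d s).comp (X + C ((-s : ℤ) : K)) = C v⁻¹ := by
    rw [← hv'] at t
    have : (d s).comp (X + C ((-s : ℤ) : K)) * (C v * C v⁻¹) = C v⁻¹ := by
      rw [← mul_assoc, ← t, one_mul]
    rwa [← C_mul, mul_inv_cancel₀ v0, C_1, mul_one] at this
  have hds : d s = C v⁻¹ := by
    have := congrArg (fun p => p.comp (X + C ((s : ℤ) : K))) hdc
    simpa [comp_assoc] using this
  refine ⟨s, v⁻¹, inv_ne_zero v0, ?_, ?_⟩
  · funext j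
    by_cases hj : j = s
    · subst hj; simp [hds]
    · rw [Pi.single_eq_of_ne hj]
      rcases lt_or_gt_of_ne hj with h | h
      · exact hs' j h
      · exact hr' j h
  · funext j
    by_cases hj : j = -s
    · subst hj; simp [hv']
    · rw [Pi.single_eq_of_ne hj]
      rcases lt_or_gt_of_ne hj with h | h
      · exact hs1' j h
      · exact hr1' j h

lemma not_inj {A : Module.End K (Polynomial K)} {a : ℤ → Polynomial K} {N : ℕ}
    (h : HSym K A a N) (ha : ∀ i, 0 ≤ i → a i = 0) : ¬ Function.Injective A := by
  intro hinj
  let f : (Fin (N + 1) → K) →ₗ[K] (Fin N → K) :=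
    (LinearMap.pi fun p : Fin N => co K p) ∘ₗ A ∘ₗ
      (∑ m : Fin (N + 1), (LinearMap.toSpanSingleton K _ (ev K m)) ∘ₗ LinearMap.proj m)
  have hf : Function.Injective f := by
    rw [injective_iff_map_eq_zero]
    intro c hc
    set w := (∑ m : Fin (N + 1), (LinearMap.toSpanSingleton K _ (ev K m)) ∘ₗ
      (LinearMap.proj m : (Fin (N + 1) → K) →ₗ[K] K)) c with hw
    have hw' : w = ∑ m : Fin (N + 1), c m • ev K m := by
      simp [hw]
    have hAw : A w = 0 := by
      apply co_ext K
      intro p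
      rw [map_zero]
      by_cases hp : p < N
      · exact congrFun hc ⟨p, hp⟩
      · rw [hw']
        simp only [map_sum, map_smul]
        apply Finset.sum_eq_zero
        intro m _
        rw [h.2 p m (by omega), ha _ (by omega)]
        simp
    have hw0 : w = 0 := hinj (by rw [hAw, map_zero])
    funext m
    have := congrArg (co K m) (hw'.symm.trans hw0)
    simpa [co_ev, Fin.val_inj] using this
  have := LinearMap.finrank_le_finrank_of_injective hf
  simp at this

lemma const_of_shift {p : Polynomial K} {c : K} (hc : c ≠ 0) (h : p.comp (X + C c) = p) :
    p = C (p.eval 0) := by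
  have h1 : ∀ n : ℕ, p.eval (n * c) = p.eval 0 := by
    intro n
    induction n with
    | zero => simp
    | succ n ih =>
      rw [← ih]
      conv_rhs => rw [← h]
      simp [add_mul]
  apply Polynomial.eq_of_infinite_eval_eq
  apply Set.Infinite.mono (s := Set.range (fun m : ℕ => (m : K) * c))
  · rintro _ ⟨m, rfl⟩; simp [h1]
  · apply Set.infinite_range_of_injective
    intro m n hmn
    exact_mod_cast mul_right_cancel₀ hc hmn

lemma eig_escape {E : Type*} [AddCommGroup E] [Module K E] (T : Module.End K E) (w : ℕ → E)
    (h0 : ∀ k, w k ≠ 0) (hT : ∀ k, T (w k) = ((k : K) + 1) • w k) (U : Submodule K E)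
    [FiniteDimensional K U] : ∃ k, w k ∉ U := by
  by_contra hc
  push Not at hc
  have li : LinearIndependent K w :=
    Module.End.eigenvectors_linearIndependent' T (fun k : ℕ => (k : K) + 1)
      (fun m n hmn => by simpa using hmn) w
      (fun k => ⟨Module.End.mem_eigenspace_iff.mpr (hT k), h0 k⟩)
  have li' : LinearIndependent K (fun k => (⟨w k, hc k⟩ : U)) :=
    LinearIndependent.of_comp U.subtype (by exact li)
  have := li'.lt_aleph0_of_finiteDimensional
  simp at this

lemma col_side {H : Module.End K (Polynomial K)} {h : ℤ → Polynomial K} {N : ℕ}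
    (hH : HSym K H h N) (w : ℕ → Polynomial K) (h0 : ∀ k, w k ≠ 0)
    (hT : ∀ k, H (w k) = ((k : K) + 1) • w k) (t : ℤ) (ht : 0 < t) (c : K) (hc : c ≠ 0)
    (htop : h t = C c) (habove : ∀ i, t < i → h i = 0) : False := by
  obtain ⟨k, hk⟩ := eig_escape H w h0 hT (Polynomial.degreeLT K N)
  set v := w k with hv
  have hd : N ≤ v.natDegree := by
    by_contra hcon
    apply hk
    rw [Polynomial.mem_degreeLT]
    exact (Polynomial.natDegree_lt_iff_degree_lt (h0 k)).mp (by rw [hv] at hcon; omega)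
  set n := v.natDegree with hn
  have hz : ∀ p, n + 1 ≤ p → co K p v = 0 := by
    intro p hp
    rw [co_eq_zero]
    exact coeff_eq_zero_of_natDegree_lt (by omega)
  have hlead : co K n v ≠ 0 := by
    rw [Ne, co_eq_zero]
    exact leadingCoeff_ne_zero.mpr (h0 k)
  have e := congrArg (co K (n + t.toNat)) (hT k)
  rw [← hv, map_smul, hz _ (by omega), smul_zero, vexp K v (n + 1) hz] at e
  simp only [map_sum, map_smul] at e
  rw [Finset.sum_eq_single n] at e
  · rw [hH.2 _ _ (by omega)] at e
    have : ((n + t.toNat : ℕ) : ℤ) - n = t := by omega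
    rw [this, htop, eval_C] at e
    exact mul_ne_zero hlead hc e
  · intro q hq hqn
    rw [Finset.mem_range] at hq
    rw [hH.2 _ _ (by omega), habove _ (by omega)]
    simp
  · simp

lemma row_side {H : Module.End K (Polynomial K)} {h : ℤ → Polynomial K} {N : ℕ}
    (hH : HSym K H h N) (w : ℕ → Module.Dual K (Polynomial K)) (h0 : ∀ k, w k ≠ 0)
    (hfin : ∀ k, ∃ M : ℕ, ∀ m, M ≤ m → w k (ev K m) = 0)
    (hT : ∀ k, w k ∘ₗ H = ((k : K) + 1) • w k) (t : ℤ) (ht : t < 0) (c : K) (hc : c ≠ 0)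
    (htop : h t = C c) (hbelow : ∀ i, i < t → h i = 0) : False := by
  let U : Submodule K (Module.Dual K (Polynomial K)) :=
    { carrier := {l | ∀ m, N ≤ m → l (ev K m) = 0}
      add_mem' := fun {a b} ha hb m hm => by simp [ha m hm, hb m hm]
      zero_mem' := fun m _ => rfl
      smul_mem' := fun c a ha m hm => by simp [ha m hm] }
  have dual_ext : ∀ l : Module.Dual K (Polynomial K), (∀ m, l (ev K m) = 0) → l = 0 := by
    intro l hl
    refine LinearMap.ext fun v => ?_
    obtain ⟨L, hL⟩ := exists_bound K v
    rw [vexp K v L hL]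
    simp [hl]
  let f : U →ₗ[K] (Fin N → K) :=
    (LinearMap.pi fun p : Fin N => Module.Dual.eval K (Polynomial K) (ev K p)) ∘ₗ U.subtype
  have hf : Function.Injective f := by
    rw [injective_iff_map_eq_zero]
    rintro ⟨l, hl⟩ hc
    apply Subtype.ext
    apply dual_ext
    intro m
    by_cases hm : m < N
    · exact congrFun hc ⟨m, hm⟩
    · exact hl m (by omega)
  have : FiniteDimensional K U := Module.Finite.of_injective f hf
  obtain ⟨k, hk⟩ := eig_escape (LinearMap.dualMap H) w h0 (fun k => hT k) U
  set l := w k with hl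
  have hk' : ∃ m, N ≤ m ∧ l (ev K m) ≠ 0 := by
    by_contra hcon
    push Not at hcon
    exact hk hcon
  obtain ⟨M, hM⟩ := hfin k
  obtain ⟨m0, hm0, hm0'⟩ := hk'
  classical
  let n := Nat.findGreatest (fun m => l (ev K m) ≠ 0) M
  have hm0M : m0 ≤ M := by by_contra hcon; exact hm0' (hM m0 (by omega))
  have hn1 : l (ev K n) ≠ 0 := Nat.findGreatest_spec (P := fun m => l (ev K m) ≠ 0) hm0M hm0'
  have hn2 : m0 ≤ n := Nat.le_findGreatest hm0M hm0'
  have hn3 : ∀ q, n < q → l (ev K q) = 0 := by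
    intro q hq
    by_cases hqM : q ≤ M
    · by_contra hcon
      exact Nat.findGreatest_is_greatest hq hqM hcon
    · exact hM q (by omega)
  have e := LinearMap.congr_fun (hT k) (ev K (n + (-t).toNat))
  rw [← hl, LinearMap.smul_apply, hn3 _ (by omega), smul_zero, LinearMap.comp_apply] at e
  obtain ⟨L, hL⟩ := exists_bound K (H (ev K (n + (-t).toNat)))
  rw [vexp K _ (L + n + 1) (fun p hp => hL p (by omega))] at e
  simp only [map_sum, map_smul] at e
  rw [Finset.sum_eq_single n] at e
  · rw [hH.2 _ _ (by omega)] at e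
    have : (n : ℤ) - ((n + (-t).toNat : ℕ) : ℤ) = t := by omega
    rw [this, htop, eval_C] at e
    exact mul_ne_zero hc hn1 e
  · intro q hq hqn
    rcases lt_or_gt_of_ne hqn with hlt | hgt
    · rw [hH.2 _ _ (by omega), hbelow _ (by omega)]
      simp
    · rw [hn3 q hgt, smul_zero]
  · intro hcon; simp at hcon

lemma main_aux {D I H : Module.End K (Polynomial K)} (mD : D ∈ I1 K) (mI : I ∈ I1 K)
    (mH : H ∈ I1 K) (hDI : D * I = 1) (hDH : D * H = H * D + D) (hHI : H * I = I * H + I)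
    (hHP : H * (1 - I * D) = 1 - I * D) (hPH : (1 - I * D) * H = 1 - I * D) :
    ∃ lam : K, lam ≠ 0 ∧ ∃ (μ : K) (h : Module.End K (Polynomial K)), h ∈ Fspan K ∧
      H = lam • Hop K + μ • (1 : Module.End K (Polynomial K)) + h := by
  obtain ⟨d, Nd, sD⟩ := exists_sym mD
  obtain ⟨i, Ni, sI⟩ := exists_sym mI
  obtain ⟨h, Nh, sH⟩ := exists_sym mH
  have q1 : smul' Ni d i = Pi.single 0 1 := by
    have := sD.mul sI
    rw [hDI] at this
    exact this.unique HSym.one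
  obtain ⟨r, u, hu, hd, hi⟩ := homog sD.1 sI.1 q1
  have q2 : smul' Nh d h = smul' Nd h d + d := by
    have h1 := sD.mul sH
    rw [hDH] at h1
    exact h1.unique ((sH.mul sD).add sD)
  have q3 : ∀ j, h j = (h j).comp (X + C (r : K)) + (if j = 0 then 1 else 0) := by
    intro j
    have e := congrFun q2 (r + j)
    rw [Pi.add_apply, smul'_single sH.1 (r + j) j (fun k hk => by
        left; rw [hd]; exact Pi.single_eq_of_ne (by omega) _),
      smul'_single sD.1 (r + j) r (fun k hk => by
        right; rw [hd]; exact Pi.single_eq_of_ne hk _), Int.add_sub_cancel, add_comm r j,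
      Int.add_sub_cancel, hd, Pi.single_eq_same, C_comp] at e
    have hCu : (C u : Polynomial K) ≠ 0 := by simpa using hu
    apply mul_left_cancel₀ hCu
    rw [e]
    split_ifs with hj
    · subst hj; simp; ring
    · rw [Pi.single_eq_of_ne (by omega)]; ring
  have hr : r ≠ 0 := by
    rintro rfl
    have := q3 0
    simp at this
  have hrK : (r : K) ≠ 0 := by exact_mod_cast hr
  have hconst : ∀ j, j ≠ 0 → ∃ c, h j = C c := by
    intro j hj
    have := q3 j
    rw [if_neg hj, add_zero] at this
    exact ⟨_, const_of_shift hrK this.symm⟩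
  obtain ⟨μ, hμ⟩ : ∃ μ, h 0 = C (-(r : K)⁻¹) * X + C μ := by
    have := q3 0
    rw [if_pos rfl] at this
    have h2 : (h 0 + C (r : K)⁻¹ * X).comp (X + C (r : K)) = h 0 + C (r : K)⁻¹ * X := by
      conv_rhs => rw [this]
      simp only [add_comp, mul_comp, C_comp, X_comp, mul_add, ← C_mul, inv_mul_cancel₀ hrK, C_1]
      ring
    have h3 := const_of_shift hrK h2
    refine ⟨eval 0 (h 0 + C (r : K)⁻¹ * X), ?_⟩
    rw [C_neg, neg_mul, ← sub_eq_neg_add, eq_sub_iff_add_eq]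
    exact h3
  -- P has symbol zero
  have sP : HSym K (1 - I * D) 0 (0 + 2 * (Ni + Nd)) := by
    have := HSym.one.sub (sI.mul sD)
    convert this using 1
    funext j
    rw [Pi.sub_apply, smul'_single sD.1 j r (fun k hk => by
        right; rw [hd]; exact Pi.single_eq_of_ne hk _), hd, hi, Pi.single_eq_same]
    by_cases hj : j = 0
    · subst hj
      rw [zero_sub, Pi.single_eq_same, Pi.single_eq_same, C_comp, ← C_mul, inv_mul_cancel₀ hu]
      simp
    · rw [Pi.single_eq_of_ne hj, Pi.single_eq_of_ne (by omega)]
      simp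
  have injI : Function.Injective I := by
    intro v w hvw
    have := congrArg D hvw
    rwa [← Module.End.mul_apply, ← Module.End.mul_apply, hDI] at this
  have surD : Function.Surjective D := fun v => ⟨I v, by
    rw [← Module.End.mul_apply, hDI]; rfl⟩
  have hrneg : r < 0 := by
    by_contra hc
    refine not_inj sI (fun j hj => ?_) injI
    rw [hi]; exact Pi.single_eq_of_ne (by omega) _
  have hP : (1 - I * D) ≠ 0 := by
    intro hP
    rw [sub_eq_zero] at hP
    refine not_inj sD (fun j hj => ?_) ?_
    · rw [hd]; exact Pi.single_eq_of_ne (by omega) _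
    · intro v w hvw
      have := congrArg I hvw
      rwa [← Module.End.mul_apply, ← Module.End.mul_apply, ← hP] at this
  have hpos : ∀ j, 0 < j → h j = 0 := by
    by_contra hcon
    push Not at hcon
    obtain ⟨j, hj, hj'⟩ := hcon
    obtain ⟨t, ht, ht'⟩ := exists_top sH.1 ⟨j, hj'⟩
    have htpos : 0 < t := by
      by_contra hc
      exact hj' (ht' j (by omega))
    obtain ⟨c, hc⟩ := hconst t (by omega)
    obtain ⟨v, hv⟩ : ∃ v, (1 - I * D) v ≠ 0 := by
      by_contra hc
      push Not at hc
      exact hP (LinearMap.ext hc)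
    refine col_side sH (fun k => (I ^ k) ((1 - I * D) v)) ?_ ?_ t htpos c ?_ hc ht'
    · intro k
      induction k with
      | zero => exact hv
      | succ k ih =>
        rw [pow_succ', Module.End.mul_apply]
        intro h0
        exact ih (injI (by rw [h0, map_zero]))
    · intro k
      induction k with
      | zero =>
        simp only [pow_zero, Module.End.one_apply, Nat.cast_zero, zero_add, one_smul]
        rw [← Module.End.mul_apply, hHP]
      | succ k ih =>
        simp only [pow_succ', Module.End.mul_apply] at ih ⊢
        rw [← Module.End.mul_apply H I, hHI, LinearMap.add_apply, Module.End.mul_apply, ih,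
          map_smul]
        push_cast
        module
    · rintro rfl
      exact ht (by simpa using hc)
  have hneg : ∀ j, j < 0 → h j = 0 := by
    by_contra hcon
    push Not at hcon
    obtain ⟨j, hj, hj'⟩ := hcon
    obtain ⟨t, ht, ht'⟩ := exists_bot sH.1 ⟨j, hj'⟩
    have htneg : t < 0 := by
      by_contra hc
      exact hj' (ht' j (by omega))
    obtain ⟨c, hc⟩ := hconst t (by omega)
    obtain ⟨v, p, hv⟩ : ∃ v p, co K p ((1 - I * D) v) ≠ 0 := by
      by_contra hc
      push Not at hc
      exact hP (LinearMap.ext fun v => co_ext K fun p => by simpa using hc v p)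
    refine row_side sH (fun k => co K p ∘ₗ ((1 - I * D) * D ^ k)) ?_ ?_ ?_ t htneg c ?_ hc ht'
    · intro k h0
      have surk : Function.Surjective (D ^ k) := by
        rw [Module.End.coe_pow]
        exact surD.iterate k
      obtain ⟨w, hw⟩ := surk v
      apply hv
      have := LinearMap.congr_fun h0 w
      rwa [LinearMap.comp_apply, Module.End.mul_apply, hw] at this
    · intro k
      obtain ⟨b, M, hb⟩ := exists_sym (pow_mem mD k)
      have := sP.mul hb
      refine ⟨2 * (0 + 2 * (Ni + Nd) + M), fun m hm => ?_⟩
      rw [LinearMap.comp_apply, this.2 p m (Or.inr hm)]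
      simp [smul']
    · intro k
      have hk : D ^ k * H = H * D ^ k + (k : K) • D ^ k := by
        induction k with
        | zero => simp
        | succ k ih =>
          rw [pow_succ, mul_assoc, hDH, mul_add, ← mul_assoc, ih]
          push_cast
          rw [add_mul, mul_assoc, smul_mul_assoc]
          module
      have hk2 : ((1 - I * D) * D ^ k) * H = ((k : K) + 1) • ((1 - I * D) * D ^ k) := by
        rw [mul_assoc, hk, mul_add, ← mul_assoc, hPH, mul_smul_comm]
        module
      show co K p ∘ₗ (((1 - I * D) * D ^ k) * H) = _
      rw [hk2, LinearMap.comp_smul]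
    · rintro rfl
      exact ht (by simpa using hc)
  refine ⟨-(r : K)⁻¹, neg_ne_zero.mpr (inv_ne_zero hrK), μ + (r : K)⁻¹,
    H - (-(r : K)⁻¹ • Hop K + (μ + (r : K)⁻¹) • (1 : Module.End K (Polynomial K))), ?_, by abel⟩
  have sF := sH.sub ((HSym.H (K := K).smul (-(r : K)⁻¹)).add
    (HSym.one (K := K).smul (μ + (r : K)⁻¹)))
  apply mem_F
  convert sF using 1
  funext j
  rcases lt_trichotomy j 0 with hj | hj | hj
  · simp [hneg j hj, Pi.single_eq_of_ne hj.ne]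
  · subst hj
    simp [hμ, smul_eq_C_mul]
    ring
  · simp [hpos j hj, Pi.single_eq_of_ne hj.ne']

end

/-- For every `K`-algebra endomorphism `σ` of `I₁` there exist a nonzero
scalar `λ ∈ K`, a scalar `μ ∈ K` and `h ∈ F` with `σ(H) = λ•H + μ•1 + h`. -/
theorem sigma_H_eq_lambda_H_add_mu_add_F (σ : I1 K →ₐ[K] I1 K) :
    ∃ lam : K, lam ≠ 0 ∧ ∃ (μ : K) (h : Module.End K (Polynomial K)), h ∈ Fspan K ∧
      ((σ (HelI K) : I1 K) : Module.End K (Polynomial K)) =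
        lam • Hop K + μ • (1 : Module.End K (Polynomial K)) + h := by
  have hs : ((σ (1 - IntI K * DelI K) : I1 K) : Module.End K (Polynomial K)) =
      1 - ((σ (IntI K) : I1 K) : Module.End K (Polynomial K)) *
        ((σ (DelI K) : I1 K) : Module.End K (Polynomial K)) := by
    have e : (1 - IntI K * DelI K) + IntI K * DelI K = 1 :=
      Subtype.ext (sub_add_cancel (1 : Module.End K (Polynomial K)) (intOp K * derOp K))
    have := congrArg (fun z => ((σ z : I1 K) : Module.End K (Polynomial K))) e
    simp only [map_add, map_mul, map_one, MulMemClass.coe_mul, AddMemClass.coe_add,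
      OneMemClass.coe_one] at this
    exact eq_sub_of_add_eq this
  refine main_aux (K := K) (D := ((σ (DelI K) : I1 K) : Module.End K (Polynomial K))) (I := ((σ (IntI K) : I1 K) : Module.End K (Polynomial K))) (H := ((σ (HelI K) : I1 K) : Module.End K (Polynomial K)))
    (σ (DelI K)).2 (σ (IntI K)).2 (σ (HelI K)).2 ?_ ?_ ?_ ?_ ?_
  · have e : DelI K * IntI K = 1 := Subtype.ext (rel_DI K)
    have := congrArg (fun z => ((σ z : I1 K) : Module.End K (Polynomial K))) e
    simpa using this
  · have e : DelI K * HelI K = HelI K * DelI K + DelI K := Subtype.ext (rel_DH K)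
    have := congrArg (fun z => ((σ z : I1 K) : Module.End K (Polynomial K))) e
    simpa using this
  · have e : HelI K * IntI K = IntI K * HelI K + IntI K := Subtype.ext (rel_HI K)
    have := congrArg (fun z => ((σ z : I1 K) : Module.End K (Polynomial K))) e
    simpa using this
  · have e : HelI K * (1 - IntI K * DelI K) = 1 - IntI K * DelI K := Subtype.ext (rel_HP K)
    have := congrArg (fun z => ((σ z : I1 K) : Module.End K (Polynomial K))) e
    simp only [map_mul, MulMemClass.coe_mul] at this
    rwa [hs] at this
  · have e : (1 - IntI K * DelI K) * HelI K = 1 - IntI K * DelI K := Subtype.ext (rel_PH K)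
    have := congrArg (fun z => ((σ z : I1 K) : Module.End K (Polynomial K))) e
    simp only [map_mul, MulMemClass.coe_mul] at this
    rwa [hs] at this

end
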